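/- arXiv:1811.00879 — 2 statements merged into one kernel-verified Lean document; each statement's English description precedes it below -/
import Mathlib

section
/- For binary chirps with identical P matrix, the shift-and-multiply reduces to a Walsh function: for all a, e ∈ ℤ₂^m and symmetric P ∈ ℤ₂^{m×m}, b ∈ ℤ₂^m, conj(φ_{P,b}(a)) · φ_{P,b}(a+e) = √Q · φ_{P,b}(e) · (−1)^{eᵀPa}, where eᵀPa is computed over ℤ₂ (equivalently, (−1) raised to the integer eᵀPa). -/
open scoped BigOperators
open Matrix

/-- The mod-4 exponent `2 bᵀv + vᵀPv` of a binary chirp, computed as a natural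
number from the `{0,1}`-valued representatives of the `ZMod 2` entries. -/
def chirpExp {m : ℕ} (P : Matrix (Fin m) (Fin m) (ZMod 2))
    (b v : Fin m → ZMod 2) : ℕ :=
  2 * ∑ i, (b i).val * (v i).val + ∑ i, ∑ j, (v i).val * (P i j).val * (v j).val

/-- The binary chirp codeword `φ_{P,b}` with power `Q`. -/
noncomputable def chirp {m : ℕ} (Q : ℝ) (P : Matrix (Fin m) (Fin m) (ZMod 2))
    (b v : Fin m → ZMod 2) : ℂ :=
  (Real.sqrt Q : ℂ) * Complex.I ^ chirpExp P b v

/-- The lift of a binary vector to its `{0,1}`-representative over `ZMod 4`. -/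
def liftVec {m : ℕ} (v : Fin m → ZMod 2) : Fin m → ZMod 4 := fun i => ((v i).val : ZMod 4)

/-- The lift of a binary matrix to its `{0,1}`-representative over `ZMod 4`. -/
def liftMat {m : ℕ} (P : Matrix (Fin m) (Fin m) (ZMod 2)) : Matrix (Fin m) (Fin m) (ZMod 4) :=
  P.map fun x => (x.val : ZMod 4)

lemma liftMat_transpose {m : ℕ} (P : Matrix (Fin m) (Fin m) (ZMod 2)) :
    (liftMat P)ᵀ = liftMat Pᵀ := rfl

lemma liftVec_add {m : ℕ} (a e : Fin m → ZMod 2) :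
    liftVec (a + e) = liftVec a + liftVec e + (2 : ZMod 4) • (liftVec a * liftVec e) := by
  have h : ∀ x y : ZMod 2, ((x + y).val : ZMod 4) =
      (x.val : ZMod 4) + (y.val : ZMod 4) + 2 * ((x.val : ZMod 4) * (y.val : ZMod 4)) := by
    decide
  funext i
  exact h (a i) (e i)

lemma natCast_bilin {m : ℕ} (P : Matrix (Fin m) (Fin m) (ZMod 2)) (v w : Fin m → ZMod 2) :
    ((∑ i, ∑ j, (v i).val * (P i j).val * (w j).val : ℕ) : ZMod 4) =
      liftVec v ⬝ᵥ liftMat P *ᵥ liftVec w := by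
  simp only [Nat.cast_sum, Nat.cast_mul, dotProduct, mulVec, liftVec, liftMat, map_apply,
    Finset.mul_sum, mul_assoc]

lemma natCast_chirpExp {m : ℕ} (P : Matrix (Fin m) (Fin m) (ZMod 2)) (b v : Fin m → ZMod 2) :
    (chirpExp P b v : ZMod 4) =
      2 * (liftVec b ⬝ᵥ liftVec v) + liftVec v ⬝ᵥ liftMat P *ᵥ liftVec v := by
  rw [chirpExp, Nat.cast_add, natCast_bilin]
  simp [dotProduct, liftVec]

lemma dotProduct_mulVec_comm_of_symm {n R : Type*} [Fintype n] [CommSemiring R]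
    {M : Matrix n n R} (hM : Mᵀ = M) (x y : n → R) : x ⬝ᵥ M *ᵥ y = y ⬝ᵥ M *ᵥ x := by
  rw [dotProduct_mulVec, ← mulVec_transpose, hM, dotProduct_comm]

lemma chirpExp_add_modEq {m : ℕ} {P : Matrix (Fin m) (Fin m) (ZMod 2)} (hP : Pᵀ = P)
    (b a e : Fin m → ZMod 2) :
    chirpExp P b (a + e) ≡ chirpExp P b a + (chirpExp P b e +
      2 * ∑ i, ∑ j, (e i).val * (P i j).val * (a j).val) [MOD 4] := by
  have hM : (liftMat P)ᵀ = liftMat P := by rw [liftMat_transpose, hP]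
  have h4 : (4 : ZMod 4) = 0 := rfl
  rw [← ZMod.natCast_eq_natCast_iff, Nat.cast_add, Nat.cast_add, Nat.cast_mul, natCast_bilin]
  simp only [natCast_chirpExp, liftVec_add]
  set x := liftVec a
  set y := liftVec e
  set z := x * y
  simp only [mulVec_add, mulVec_smul, dotProduct_add, add_dotProduct, smul_dotProduct,
    dotProduct_smul, smul_eq_mul]
  rw [dotProduct_mulVec_comm_of_symm hM x y, dotProduct_mulVec_comm_of_symm hM z x,
    dotProduct_mulVec_comm_of_symm hM z y]
  push_cast
  linear_combination (liftVec b ⬝ᵥ z + x ⬝ᵥ liftMat P *ᵥ z + y ⬝ᵥ liftMat P *ᵥ z +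
    z ⬝ᵥ liftMat P *ᵥ z) * h4

lemma Complex.I_pow_congr {k l : ℕ} (h : k ≡ l [MOD 4]) : Complex.I ^ k = Complex.I ^ l := by
  rw [Complex.I_pow_eq_pow_mod k, Complex.I_pow_eq_pow_mod l, h]

lemma Complex.conj_I_pow_mul_I_pow (k : ℕ) :
    (starRingEnd ℂ) (Complex.I ^ k) * Complex.I ^ k = 1 := by
  rw [map_pow, ← mul_pow, Complex.conj_I, neg_mul, Complex.I_mul_I, neg_neg, one_pow]

/-- For chirps with identical `P`, shift-and-multiply reduces to a Walsh function:
`conj (φ_{P,b}(a)) * φ_{P,b}(a+e) = √Q * φ_{P,b}(e) * (-1)^(eᵀ P a)`. -/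
theorem chirp_shift_multiply_same (m : ℕ) (hm : 1 ≤ m) (Q : ℝ) (hQ : 0 < Q)
    (P : Matrix (Fin m) (Fin m) (ZMod 2)) (hP : Pᵀ = P)
    (b : Fin m → ZMod 2) (a e : Fin m → ZMod 2) :
    (starRingEnd ℂ) (chirp Q P b a) * chirp Q P b (a + e)
      = (Real.sqrt Q : ℂ) * chirp Q P b e
          * (-1 : ℂ) ^ (∑ i, ∑ j, (e i).val * (P i j).val * (a j).val) := by
  simp only [chirp, map_mul, Complex.conj_ofReal]
  rw [Complex.I_pow_congr (chirpExp_add_modEq hP b a e), pow_add, pow_add, pow_mul, Complex.I_sq]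
  linear_combination (Real.sqrt Q : ℂ) * Real.sqrt Q * Complex.I ^ chirpExp P b e *
    (-1 : ℂ) ^ (∑ i, ∑ j, (e i).val * (P i j).val * (a j).val) *
    Complex.conj_I_pow_mul_I_pow (chirpExp P b a)
end

section
/- Two distinct binary chirps with the same P matrix are orthogonal: if b ≠ b', then ∑_{v ∈ ℤ₂^m} conj(φ_{P,b}(v)) · φ_{P,b'}(v) = 0. -/
open scoped BigOperators
open Matrix

/-- The inner-product summand of two chirps with the same `P` matrix is, up to the power `Q`,
a real character factoring over the coordinates. -/
theorem conj_chirp_mul_chirp {m : ℕ} (Q : ℝ) (hQ : 0 ≤ Q)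
    (P : Matrix (Fin m) (Fin m) (ZMod 2)) (b b' v : Fin m → ZMod 2) :
    (starRingEnd ℂ) (chirp Q P b v) * chirp Q P b' v =
      (Q : ℂ) * ∏ i, (-1 : ℂ) ^ (((b i).val + (b' i).val) * (v i).val) := by
  have hsqrt : (Real.sqrt Q : ℂ) * (Real.sqrt Q : ℂ) = Q := by
    exact_mod_cast Real.mul_self_sqrt hQ
  have hI (k : ℕ) : (-Complex.I) ^ k * Complex.I ^ k = 1 := by
    rw [← mul_pow]
    simp
  rw [Finset.prod_pow_eq_pow_sum]
  simp only [chirp, chirpExp, map_mul, map_pow, map_neg, map_one, Complex.conj_ofReal,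
    Complex.conj_I, pow_add, pow_mul, Complex.I_sq, add_mul, Finset.sum_add_distrib]
  linear_combination
    (-1 : ℂ) ^ (∑ i, (b i).val * (v i).val) * (-1) ^ (∑ i, (b' i).val * (v i).val) *
      ((Real.sqrt Q : ℂ) * (Real.sqrt Q : ℂ) *
        hI (∑ i, ∑ j, (v i).val * (P i j).val * (v j).val) + hsqrt)

/-- A nontrivial sign character of `ZMod 2` sums to zero. -/
theorem sum_neg_one_pow_val_eq_zero {a c : ZMod 2} (h : a ≠ c) :
    ∑ x : ZMod 2, (-1 : ℂ) ^ ((a.val + c.val) * x.val) = 0 := by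
  have hodd : a.val + c.val = 1 := by
    revert a c
    decide
  have huniv : (Finset.univ : Finset (ZMod 2)) = {0, 1} := rfl
  simp [hodd, huniv, ZMod.val_one]

/-- Two distinct binary chirps with the same `P` matrix are orthogonal. -/
theorem chirp_orthogonal (m : ℕ) (hm : 1 ≤ m) (Q : ℝ) (hQ : 0 < Q)
    (P : Matrix (Fin m) (Fin m) (ZMod 2)) (hP : Pᵀ = P)
    (b b' : Fin m → ZMod 2) (hbb : b ≠ b') :
    ∑ v : Fin m → ZMod 2, (starRingEnd ℂ) (chirp Q P b v) * chirp Q P b' v = 0 := by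
  obtain ⟨i, hi⟩ := Function.ne_iff.mp hbb
  simp only [conj_chirp_mul_chirp Q hQ.le, ← Finset.mul_sum]
  rw [← Fintype.prod_sum fun i (x : ZMod 2) => (-1 : ℂ) ^ (((b i).val + (b' i).val) * x.val),
    Finset.prod_eq_zero (Finset.mem_univ i) (sum_neg_one_pow_val_eq_zero hi), mul_zero]
end
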